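/- arXiv:1305.1312 — 7 statements merged into one kernel-verified Lean document; each statement's English description precedes it below -/
import Mathlib

section
/- For all integers i, j ≥ 0, the cardinality of the set P_{i,j} of non-intersecting triples of up-right lattice paths equals the Baxter number Θ_{ij}. -/
/-- A step of an up-right lattice path: `true` is an up-step `(1,0)`,
`false` is a right-step `(0,1)`. -/
def stepVec : Bool → ℤ × ℤ
  | true => (1, 0)
  | false => (0, 1)

/-- The set of vertices (points of `ℤ²`) visited by the up-right path
starting at `s` with step sequence `l`. -/
def pathVertices (s : ℤ × ℤ) (l : List Bool) : Set (ℤ × ℤ) :=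
  { v | ∃ k, k ≤ l.length ∧ v = s + ((l.take k).map stepVec).sum }

/-- The step sequence `l` has exactly `i` right-steps and `j` up-steps. -/
def UpRight (i j : ℕ) (l : List Bool) : Prop :=
  l.count false = i ∧ l.count true = j

/-- `P_{i,j}`: non-intersecting triples of up-right paths, each with `i` right-steps and
`j` up-steps, starting respectively at `(-1,1)`, `(0,0)` and `(1,-1)`; a triple is encoded
by its three step sequences. -/
def Pset (i j : ℕ) : Set (List Bool × List Bool × List Bool) :=
  { p | UpRight i j p.1 ∧ UpRight i j p.2.1 ∧ UpRight i j p.2.2 ∧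
        pathVertices (-1, 1) p.1 ∩ pathVertices (0, 0) p.2.1 = ∅ ∧
        pathVertices (-1, 1) p.1 ∩ pathVertices (1, -1) p.2.2 = ∅ ∧
        pathVertices (0, 0) p.2.1 ∩ pathVertices (1, -1) p.2.2 = ∅ }

/-- The Baxter number `Θ_{ij}` as a rational number. -/
noncomputable def baxter (i j : ℕ) : ℚ :=
  (2 * (Nat.factorial (i + j)) * (Nat.factorial (i + j + 1)) *
      (Nat.factorial (i + j + 2)) : ℚ) /
    ((Nat.factorial i) * (Nat.factorial (i + 1)) * (Nat.factorial (i + 2)) *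
      (Nat.factorial j) * (Nat.factorial (j + 1)) * (Nat.factorial (j + 2)))

def cc : ℕ → ℤ → ℚ
  | 0, k => if k = 0 then 1 else 0
  | n + 1, k => cc n k + cc n (k - 1)

lemma cc_neg (n : ℕ) : ∀ k : ℤ, k < 0 → cc n k = 0 := by
  induction n with
  | zero => intro k hk; simp [cc, hk.ne]
  | succ n ih => intro k hk; simp [cc, ih k hk, ih (k - 1) (by omega)]

lemma cc_choose (n : ℕ) : ∀ k : ℕ, cc n k = (n.choose k : ℚ) := by
  induction n with
  | zero => intro k; cases k <;> simp [cc]; omega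
  | succ n ih =>
    intro k
    cases k with
    | zero =>
      have := ih 0
      have h2 := cc_neg n (-1) (by norm_num)
      simp only [Nat.cast_zero] at this
      simp [cc, this, h2]
    | succ k =>
      have h1 := ih (k + 1)
      have h2 := ih k
      have e : ((k + 1 : ℕ) : ℤ) - 1 = k := by push_cast; ring
      rw [cc, e, h1, h2, Nat.choose_succ_succ]
      push_cast; ring

lemma cc_ratio (n : ℕ) : ∀ k : ℤ, ((k : ℚ) + 1) * cc n (k + 1) = ((n : ℚ) - k) * cc n k := by
  induction n with
  | zero =>
    intro k
    simp only [cc]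
    by_cases h : k = 0
    · subst h; simp
    · by_cases h' : k + 1 = 0
      · have : k = -1 := by omega
        subst this; simp
      · simp [h, h']
  | succ n ih =>
    intro k
    have h1 := ih k
    have h2 := ih (k - 1)
    rw [sub_add_cancel] at h2
    simp only [cc, add_sub_cancel_right]
    push_cast at *
    linear_combination h1 + h2

def DD (j : ℤ) (n : ℕ) (a b c : ℤ) : ℚ :=
  cc n (j - 1 - a) * (cc n (j - b) * cc n (j + 1 - c) - cc n (j - c) * cc n (j + 1 - b))
  - cc n (j - 1 - b) * (cc n (j - a) * cc n (j + 1 - c) - cc n (j - c) * cc n (j + 1 - a))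
  + cc n (j - 1 - c) * (cc n (j - a) * cc n (j + 1 - b) - cc n (j - b) * cc n (j + 1 - a))

def bz (x : Bool) : ℤ := if x then 1 else 0

def consEmb (x : Bool × Bool × Bool) :
    (List Bool × List Bool × List Bool) ↪ (List Bool × List Bool × List Bool) where
  toFun p := (x.1 :: p.1, x.2.1 :: p.2.1, x.2.2 :: p.2.2)
  inj' := by
    rintro ⟨p, q, r⟩ ⟨p', q', r'⟩ h
    simpa using h

lemma consEmb_apply (x : Bool × Bool × Bool) (p : List Bool × List Bool × List Bool) :
    consEmb x p = (x.1 :: p.1, x.2.1 :: p.2.1, x.2.2 :: p.2.2) := rfl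

def TT (j : ℤ) : ℕ → ℤ → ℤ → ℤ → Finset (List Bool × List Bool × List Bool)
  | 0, a, b, c => if a = j - 1 ∧ b = j ∧ c = j + 1 then {([], [], [])} else ∅
  | n + 1, a, b, c => if a < b ∧ b < c then
      (Finset.univ : Finset (Bool × Bool × Bool)).biUnion fun x =>
        (TT j n (a + bz x.1) (b + bz x.2.1) (c + bz x.2.2)).map (consEmb x)
      else ∅

lemma cc_step (n : ℕ) (u a : ℤ) : cc (n + 1) (u - a) = cc n (u - a) + cc n (u - (a + 1)) := by
  rw [cc]; congr 2; ring

lemma DD_step (j : ℤ) (n : ℕ) (a b c : ℤ) : DD j (n + 1) a b c =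
    ∑ x : Bool × Bool × Bool, DD j n (a + bz x.1) (b + bz x.2.1) (c + bz x.2.2) := by
  simp only [Fintype.sum_prod_type, Fintype.sum_bool, bz, if_true, add_zero, Bool.false_eq_true,
    if_false, DD, cc_step]
  ring

lemma TT_card (j : ℤ) (n : ℕ) : ∀ a b c : ℤ, a ≤ b → b ≤ c →
    ((TT j n a b c).card : ℚ) = DD j n a b c := by
  induction n with
  | zero =>
    intro a b c hab hbc
    by_cases h : a = j - 1 ∧ b = j ∧ c = j + 1
    · obtain ⟨rfl, rfl, rfl⟩ := h
      simp [TT, DD, cc]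
    · simp only [TT, h, if_false, DD, cc]
      simp only [Finset.card_empty, Nat.cast_zero]
      split_ifs <;> first | omega | norm_num
  | succ n ih =>
    intro a b c hab hbc
    by_cases h : a < b ∧ b < c
    · rw [TT, if_pos h, Finset.card_biUnion]
      · rw [DD_step]
        push_cast
        refine Finset.sum_congr rfl fun x _ => ?_
        rw [Finset.card_map]
        obtain ⟨x, y, z⟩ := x
        apply ih <;> cases x <;> cases y <;> cases z <;> simp [bz] <;> omega
      · intro x _ y _ hxy
        refine Finset.disjoint_left.2 ?_
        intro p hp hq
        simp only [Finset.mem_map, consEmb_apply] at hp hq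
        obtain ⟨p1, -, rfl⟩ := hp
        obtain ⟨q1, -, h2⟩ := hq
        simp at h2
        apply hxy
        ext <;> simp [h2]
    · rw [TT, if_neg h]
      have : a = b ∨ b = c := by omega
      rcases this with rfl | rfl <;> simp only [DD, Finset.card_empty, Nat.cast_zero] <;> ring

lemma pv_nil (s : ℤ × ℤ) : pathVertices s [] = {s} := by
  ext v; simp [pathVertices]

lemma pv_cons (s : ℤ × ℤ) (x : Bool) (l : List Bool) :
    pathVertices s (x :: l) = {s} ∪ pathVertices (s + stepVec x) l := by
  ext v
  simp only [pathVertices, Set.mem_ofPred_eq, Set.mem_union, Set.mem_singleton_iff]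
  constructor
  · rintro ⟨k, hk, rfl⟩
    cases k with
    | zero => left; simp
    | succ k => right; exact ⟨k, by simpa using hk, by simp [add_assoc]⟩
  · rintro (rfl | ⟨k, hk, rfl⟩)
    · exact ⟨0, by simp, by simp⟩
    · exact ⟨k + 1, by simpa using hk, by simp [add_assoc]⟩

lemma pv_sum (l : List Bool) : ∀ (s v : ℤ × ℤ), v ∈ pathVertices s l → s.1 + s.2 ≤ v.1 + v.2 := by
  induction l with
  | nil => intro s v h; rw [pv_nil] at h; rw [Set.mem_singleton_iff.1 h]
  | cons x l ih =>
    intro s v h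
    rw [pv_cons] at h
    rcases h with h | h
    · rw [Set.mem_singleton_iff.1 h]
    · have := ih _ _ h
      cases x <;> simp [stepVec] at this <;> omega

lemma step_eq (t a : ℤ) (x : Bool) :
    ((a, t - a) : ℤ × ℤ) + stepVec x = (a + bz x, (t + 1) - (a + bz x)) := by
  cases x <;> simp [stepVec, bz] <;> ring

lemma disj_cons (t a b : ℤ) (x y : Bool) (l m : List Bool) :
    pathVertices (a, t - a) (x :: l) ∩ pathVertices (b, t - b) (y :: m) = ∅ ↔
    a ≠ b ∧ pathVertices (a + bz x, (t + 1) - (a + bz x)) l ∩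
      pathVertices (b + bz y, (t + 1) - (b + bz y)) m = ∅ := by
  simp only [pv_cons, step_eq, ← Set.disjoint_iff_inter_eq_empty, Set.disjoint_union_left,
    Set.disjoint_union_right, Set.disjoint_singleton_left, Set.disjoint_singleton_right,
    Set.mem_singleton_iff, Set.mem_union, not_or]
  constructor
  · rintro ⟨⟨h1, h2⟩, h3, h4⟩
    exact ⟨fun h => h1 (by subst h; simp), h4⟩
  · rintro ⟨h1, h2⟩
    refine ⟨⟨fun h => h1 ?_, fun h => ?_⟩, fun h => ?_, h2⟩
    · exact (congrArg Prod.fst h).symm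
    · have := pv_sum _ _ _ h; simp at this
    · have := pv_sum _ _ _ h; simp at this

lemma count_cons_bz (x : Bool) (l : List Bool) :
    (((x :: l).count true : ℕ) : ℤ) = bz x + l.count true := by
  cases x <;> simp [bz]; ring

lemma TT_mem (j : ℤ) (n : ℕ) : ∀ (t a b c : ℤ) (p q r : List Bool), a ≤ b → b ≤ c →
    ((p, q, r) ∈ TT j n a b c ↔
      (p.length = n ∧ q.length = n ∧ r.length = n) ∧
      (a + p.count true = j - 1 ∧ b + q.count true = j ∧ c + r.count true = j + 1) ∧
      pathVertices (a, t - a) p ∩ pathVertices (b, t - b) q = ∅ ∧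
      pathVertices (a, t - a) p ∩ pathVertices (c, t - c) r = ∅ ∧
      pathVertices (b, t - b) q ∩ pathVertices (c, t - c) r = ∅) := by
  induction n with
  | zero =>
    intro t a b c p q r hab hbc
    by_cases h : a = j - 1 ∧ b = j ∧ c = j + 1
    · rw [TT, if_pos h]
      obtain ⟨rfl, rfl, rfl⟩ := h
      simp only [Finset.mem_singleton, Prod.mk.injEq, List.length_eq_zero_iff]
      constructor
      · rintro ⟨rfl, rfl, rfl⟩
        simp [pv_nil]
        omega
      · exact fun h => h.1
    · rw [TT, if_neg h]
      simp only [Finset.notMem_empty, false_iff, List.length_eq_zero_iff]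
      rintro ⟨⟨rfl, rfl, rfl⟩, h', -⟩
      simp at h'
      exact h h'
  | succ n ih =>
    intro t a b c p q r hab hbc
    rcases p with _ | ⟨x, p⟩
    · rw [TT]; split_ifs <;> simp [consEmb_apply]
    rcases q with _ | ⟨y, q⟩
    · rw [TT]; split_ifs <;> simp [consEmb_apply]
    rcases r with _ | ⟨z, r⟩
    · rw [TT]; split_ifs <;> simp [consEmb_apply]
    simp only [disj_cons, count_cons_bz, List.length_cons, Nat.add_right_cancel_iff]
    by_cases h : a < b ∧ b < c
    · have key : (x :: p, y :: q, z :: r) ∈ TT j (n + 1) a b c ↔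
          (p, q, r) ∈ TT j n (a + bz x) (b + bz y) (c + bz z) := by
        rw [TT, if_pos h]
        simp only [Finset.mem_biUnion, Finset.mem_univ, true_and, Finset.mem_map, consEmb_apply, Prod.mk.injEq, List.cons.injEq]
        constructor
        · rintro ⟨⟨x', y', z'⟩, ⟨p', q', r'⟩, hm, ⟨h1, h2⟩, ⟨h3, h4⟩, h5, h6⟩
          simp only at h1 h2 h3 h4 h5 h6 hm
          subst h1 h2 h3 h4 h5 h6
          exact hm
        · intro hm
          exact ⟨(x, y, z), (p, q, r), hm, by simp⟩
      rw [key, ih (t + 1)]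
      · have h1 : a ≠ b := h.1.ne
        have h2 : b ≠ c := h.2.ne
        have h3 : a ≠ c := (h.1.trans h.2).ne
        simp only [h1, h2, h3, ne_eq, not_false_eq_true, true_and, add_assoc]
      · cases x <;> cases y <;> simp [bz] <;> omega
      · cases z <;> cases y <;> simp [bz] <;> omega
    · rw [TT, if_neg h]
      simp only [Finset.notMem_empty, false_iff]
      rintro ⟨-, -, ⟨h1, -⟩, -, ⟨h2, -⟩⟩
      omega

lemma Pset_eq (i j : ℕ) : Pset i j = ↑(TT (j : ℤ) (i + j) (-1) 0 1) := by
  ext ⟨p, q, r⟩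
  rw [Finset.mem_coe, TT_mem _ _ 0 _ _ _ _ _ _ (by norm_num) (by norm_num)]
  have hp := List.count_false_add_count_true p
  have hq := List.count_false_add_count_true q
  have hr := List.count_false_add_count_true r
  simp only [Pset, UpRight, Set.mem_ofPred_eq]
  have e1 : ((0 : ℤ) - -1) = 1 := by norm_num
  have e2 : ((0 : ℤ) - 0) = 0 := by norm_num
  have e3 : ((0 : ℤ) - 1) = -1 := by norm_num
  rw [e1, e2, e3]
  constructor
  · rintro ⟨h1, h2, h3, h4⟩
    exact ⟨by omega, by omega, h4⟩
  · rintro ⟨h1, h2, h4⟩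
    exact ⟨by omega, by omega, by omega, h4⟩

lemma DD_eval (i j : ℕ) : DD j (i + j) (-1) 0 1 = baxter i j := by
  have r0 := cc_ratio (i + j) j
  have r1 := cc_ratio (i + j) (j + 1)
  have r2 := cc_ratio (i + j) (j - 1)
  have r3 := cc_ratio (i + j) (j - 2)
  have hc : cc (i + j) j = ((i + j).factorial : ℚ) / (i.factorial * j.factorial) := by
    rw [cc_choose, Nat.add_choose]
    rw [Nat.cast_div (Nat.factorial_mul_factorial_dvd_factorial_add i j) (by positivity)]
    push_cast; ring
  have e1 : (j : ℤ) + 1 + 1 = j + 2 := by ring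
  have e2 : (j : ℤ) - 1 + 1 = j := by ring
  have e3 : (j : ℤ) - 2 + 1 = j - 1 := by ring
  rw [e1] at r1
  rw [e2] at r2
  rw [e3] at r3
  push_cast at r0 r1 r2 r3
  have hi1 : (i : ℚ) + 1 ≠ 0 := by positivity
  have hi2 : (i : ℚ) + 2 ≠ 0 := by positivity
  have hj1 : (j : ℚ) + 1 ≠ 0 := by positivity
  have hj2 : (j : ℚ) + 2 ≠ 0 := by positivity
  have s0 : cc (i + j) (j + 1) = i / (j + 1) * cc (i + j) j := by
    field_simp; linear_combination r0
  have s1 : cc (i + j) (j + 2) = (i - 1) / (j + 2) * cc (i + j) (j + 1) := by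
    field_simp; linear_combination r1
  have s2 : cc (i + j) (j - 1) = j / (i + 1) * cc (i + j) j := by
    field_simp; linear_combination -r2
  have s3 : cc (i + j) (j - 2) = (j - 1) / (i + 2) * cc (i + j) (j - 1) := by
    field_simp; linear_combination -r3
  have d1 : (j : ℤ) - 1 - -1 = j := by ring
  have d2 : (j : ℤ) - 1 - 0 = j - 1 := by ring
  have d3 : (j : ℤ) - 1 - 1 = j - 2 := by ring
  have d4 : (j : ℤ) - -1 = j + 1 := by ring
  have d5 : (j : ℤ) + 1 - -1 = j + 2 := by ring
  have d6 : (j : ℤ) + 1 - 1 = j := by ring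
  simp only [DD, d1, d2, d3, d4, d5, d6, sub_zero]
  rw [s3, s1, s2, s0, hc, baxter]
  simp only [Nat.factorial_succ]
  push_cast
  have f1 : (i.factorial : ℚ) ≠ 0 := by positivity
  have f2 : (j.factorial : ℚ) ≠ 0 := by positivity
  have hi2' : (i : ℚ) + 1 + 1 ≠ 0 := by positivity
  have hj2' : (j : ℚ) + 1 + 1 ≠ 0 := by positivity
  field_simp
  ring

theorem card_Pset_eq_baxter (i j : ℕ) :
    ((Pset i j).ncard : ℚ) = baxter i j := by
  rw [Pset_eq, Set.ncard_coe_finset, TT_card _ _ _ _ _ (by norm_num) (by norm_num), DD_eval]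
end

section
/- For all integers i, j ≥ 0, the determinant of the 3×3 matrix whose entry in row a and column b (a, b ∈ {1,2,3}) is the binomial coefficient C(i+j, i+b−a), with the convention that C(n,k) = 0 when k < 0 or k > n, equals the Baxter number Θ_{ij}. -/
theorem up_step (n k : ℕ) (h : k ≤ n) :
    (n.choose (k+1) : ℚ) * (k+1) = n.choose k * ((n:ℚ) - k) := by
  have := Nat.choose_succ_right_eq n k
  rw [← Nat.cast_sub h]
  exact_mod_cast this

theorem det_binomial_eq_baxter (i j : ℕ) :
    (Matrix.of fun a b : Fin 3 =>
        if (a.val : ℤ) ≤ (i : ℤ) + b.val then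
          (((i + j).choose (((i : ℤ) + b.val - a.val).toNat) : ℕ) : ℚ)
        else 0).det = baxter i j := by
  set f : ℤ → ℚ := fun d => if 0 ≤ (i:ℤ) + d then
    (((i + j).choose (((i : ℤ) + d).toNat) : ℕ) : ℚ) else 0 with hf
  have hM : (Matrix.of fun a b : Fin 3 =>
        if (a.val : ℤ) ≤ (i : ℤ) + b.val then
          (((i + j).choose (((i : ℤ) + b.val - a.val).toNat) : ℕ) : ℚ)
        else 0) = Matrix.of fun a b : Fin 3 => f ((b.val : ℤ) - a.val) := by
    ext a b
    simp only [hf, Matrix.of_apply, add_sub_assoc]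
    congr 1
    apply propext
    constructor <;> intro h <;> omega
  have hi1 : (i:ℚ) + 1 ≠ 0 := by positivity
  have hi2 : (i:ℚ) + 2 ≠ 0 := by positivity
  have hj1 : (j:ℚ) + 1 ≠ 0 := by positivity
  have hj2 : (j:ℚ) + 2 ≠ 0 := by positivity
  have h0 : f 0 = (i+j).choose i := by simp [hf]
  obtain ⟨c, hc⟩ : ∃ c : ℚ, c = (i+j).choose i := ⟨_, rfl⟩
  have u1 := up_step (i+j) i (by omega)
  rw [← hc] at u1 h0
  push_cast at u1
  have h1 : f 1 = c * j / (i+1) := by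
    have : f 1 = (i+j).choose (i+1) := by
      simp only [hf]; rw [if_pos (by omega)]; congr 2
    rw [this, eq_div_iff hi1, u1]; ring
  have h2 : f 2 = c * j * (j-1) / ((i+1)*(i+2)) := by
    have e : f 2 = (i+j).choose (i+2) := by
      simp only [hf]; rw [if_pos (by omega)]; congr 2
    rw [e, eq_div_iff (by positivity)]
    rcases j with _ | j
    · simp [Nat.choose_eq_zero_of_lt (show i < i + 2 by omega)]
    · have u2 := up_step (i+(j+1)) (i+1) (by omega)
      push_cast at u1 u2 ⊢
      rw [show i + 1 + 1 = i + 2 from rfl] at u2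
      linear_combination (i+1:ℚ) * u2 + (j:ℚ) * u1
  have hm1 : f (-1) = c * i / (j+1) := by
    rw [eq_div_iff hj1]
    rcases i with _ | i
    · simp [hf]
    · have e : f (-1) = (i+1+j).choose i := by
        simp only [hf]; rw [if_pos (by omega)]; congr 2; omega
      have u := up_step (i+1+j) i (by omega)
      rw [e, hc]; push_cast at u ⊢
      linear_combination -u
  have hm2 : f (-2) = c * i * (i-1) / ((j+1)*(j+2)) := by
    rw [eq_div_iff (by positivity)]
    rcases i with _ | _ | i
    · simp [hf]
    · simp [hf]
    · have e : f (-2) = (i+1+1+j).choose i := by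
        simp only [hf]; rw [if_pos (by omega)]; congr 2; omega
      have u := up_step (i+1+1+j) i (by omega)
      have u' := up_step (i+1+1+j) (i+1) (by omega)
      rw [e, hc]; push_cast at u u' ⊢
      linear_combination -(j+1:ℚ) * u - (i+1:ℚ) * u'
  have hc' : c = ((i+j).factorial : ℚ) / (i.factorial * j.factorial) := by
    rw [hc, Nat.cast_add_choose]
  have g1 : (i.factorial : ℚ) ≠ 0 := by positivity
  have g2 : (j.factorial : ℚ) ≠ 0 := by positivity
  rw [hM, Matrix.det_fin_three]
  simp only [Matrix.of_apply, Fin.val_zero, Fin.val_one, Fin.val_two]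
  norm_num only [h0, h1, h2, hm1, hm2]
  rw [hc', baxter]
  simp only [Nat.factorial_succ]
  push_cast
  field_simp
  ring
end

section
/- Let w be a word over A such that w|_{{e,ē}} is a Dyck word (with e as opening letter), and set w^1 = w|_{{e,b̄}} and w^2 = w|_{{ē,b̄}}. Then for every ℓ with 0 ≤ ℓ ≤ min(|w^1|, |w^2|), one has |w^1_{≤ℓ}|_{b̄} ≤ |w^2_{≤ℓ}|_{b̄} and |w^1_{≤ℓ}|_e ≥ |w^2_{≤ℓ}|_{ē}. -/
/-- The four-letter alphabet `A = {e, ē, b, b̄}`; `eb` stands for `ē` and `bb` for `b̄`. -/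
inductive A : Type
  | e | eb | b | bb
  deriving DecidableEq

/-- `w` is a Dyck word with opening letter `o` and closing letter `c`. -/
def IsDyck (o c : A) (w : List A) : Prop :=
  w.count o = w.count c ∧ ∀ ℓ : ℕ, (w.take ℓ).count c ≤ (w.take ℓ).count o

/-- `w^1 = w|_{{e,b̄}}`. -/
def sub1 (w : List A) : List A := w.filter (fun x => x == A.e || x == A.bb)

/-- `w^2 = w|_{{ē,b̄}}`. -/
def sub2 (w : List A) : List A := w.filter (fun x => x == A.eb || x == A.bb)

/-- `w^3 = w|_{{ē,b}}`. -/
def sub3 (w : List A) : List A := w.filter (fun x => x == A.eb || x == A.b)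

/-- Conditions (1)–(5) on a word over `A` (positions are 0-indexed). -/
def Conds (w : List A) : Prop :=
  (w[0]? = some A.e ∧ w[1]? = some A.b) ∧
  IsDyck A.e A.eb (w.filter (fun x => x == A.e || x == A.eb)) ∧
  IsDyck A.b A.bb (w.filter (fun x => x == A.b || x == A.bb)) ∧
  (∀ p q : ℕ, p < q → w[p]? = some A.b → w[q]? = some A.bb →
      ∃ k, p ≤ k ∧ k ≤ q ∧ w[k]? = some A.eb) ∧
  (∀ p q : ℕ, 0 < p → p < q → w[p]? = some A.e → w[q]? = some A.eb →
      ∃ k, p ≤ k ∧ k ≤ q ∧ w[k]? = some A.bb)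

/-- The set `W_{i,j}`. -/
def Wset (i j : ℕ) : Set (List A) :=
  { w | w.count A.e = j + 1 ∧ w.count A.eb = j + 1 ∧
        w.count A.b = i + 1 ∧ w.count A.bb = i + 1 ∧ Conds w }

theorem aux_take_filter (p : A → Bool) (w : List A) (l : ℕ) (hl : l ≤ (w.filter p).length) :
    ∃ n, (w.filter p).take l = (w.take n).filter p := by
  induction w generalizing l with
  | nil => exact ⟨0, by simp⟩
  | cons a t ih =>
    by_cases ha : p a = true
    · cases l with
      | zero => exact ⟨0, by simp⟩
      | succ l =>
        rw [List.filter_cons_of_pos ha] at hl ⊢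
        obtain ⟨n, hn⟩ := ih l (by simpa using hl)
        exact ⟨n + 1, by rw [List.take_succ_cons, List.take_succ_cons, List.filter_cons_of_pos ha, hn]⟩
    · rw [List.filter_cons_of_neg ha] at hl ⊢
      obtain ⟨n, hn⟩ := ih l hl
      exact ⟨n + 1, by rw [List.take_succ_cons, List.filter_cons_of_neg ha, hn]⟩

theorem aux_len1 (w : List A) : (sub1 w).length = w.count A.e + w.count A.bb := by
  induction w with
  | nil => rfl
  | cons a t ih =>
    unfold sub1 at *
    cases a <;> simp [List.filter_cons, List.count_cons, ih] <;> omega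

theorem aux_len2 (w : List A) : (sub2 w).length = w.count A.eb + w.count A.bb := by
  induction w with
  | nil => rfl
  | cons a t ih =>
    unfold sub2 at *
    cases a <;> simp [List.filter_cons, List.count_cons, ih] <;> omega

theorem aux_dyck (w : List A)
    (h : IsDyck A.e A.eb (w.filter (fun x => x == A.e || x == A.eb))) (n : ℕ) :
    (w.take n).count A.eb ≤ (w.take n).count A.e := by
  have h1 := ((List.take_prefix n w).filter (fun x => x == A.e || x == A.eb))
  have h2 := h.2 ((w.take n).filter (fun x => x == A.e || x == A.eb)).length
  rw [← List.prefix_iff_eq_take.1 h1] at h2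
  rwa [List.count_filter (by decide), List.count_filter (by decide)] at h2

theorem prefixes_sub1_sub2 (w : List A)
    (h : IsDyck A.e A.eb (w.filter (fun x => x == A.e || x == A.eb))) :
    ∀ ℓ : ℕ, ℓ ≤ min (sub1 w).length (sub2 w).length →
      ((sub1 w).take ℓ).count A.bb ≤ ((sub2 w).take ℓ).count A.bb ∧
      ((sub2 w).take ℓ).count A.eb ≤ ((sub1 w).take ℓ).count A.e := by
  intro l hl
  have hl1 : l ≤ (sub1 w).length := le_trans hl (min_le_left _ _)
  have hl2 : l ≤ (sub2 w).length := le_trans hl (min_le_right _ _)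
  obtain ⟨m, hm⟩ := aux_take_filter _ w l hl1
  obtain ⟨n, hn⟩ := aux_take_filter _ w l hl2
  change (sub1 w).take l = sub1 (w.take m) at hm
  change (sub2 w).take l = sub2 (w.take n) at hn
  have e1 := aux_len1 (w.take m)
  have e2 := aux_len2 (w.take n)
  rw [← hm, List.length_take, min_eq_left hl1] at e1
  rw [← hn, List.length_take, min_eq_left hl2] at e2
  have hd := aux_dyck w h n
  rw [hm, hn]
  unfold sub1 sub2
  rw [List.count_filter (by decide), List.count_filter (by decide),
    List.count_filter (by decide), List.count_filter (by decide)]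
  rcases le_total m n with hmn | hmn
  · have := (List.take_prefix_take_left (l := w) hmn).sublist.count_le A.bb
    omega
  · have := (List.take_prefix_take_left (l := w) hmn).sublist.count_le A.e
    omega
end

section
/- Let w be a word over A such that w|_{{b,b̄}} is a Dyck word (with b as opening letter), and set w^2 = w|_{{ē,b̄}} and w^3 = w|_{{ē,b}}. Then for every ℓ with 0 ≤ ℓ ≤ min(|w^2|, |w^3|), one has |w^3_{≤ℓ}|_{ē} ≤ |w^2_{≤ℓ}|_{ē} and |w^3_{≤ℓ}|_b ≥ |w^2_{≤ℓ}|_{b̄}. -/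
theorem aux_count3 (p : List A) : (sub3 p).length = p.count A.eb + p.count A.b ∧
    (sub3 p).count A.eb = p.count A.eb ∧ (sub3 p).count A.b = p.count A.b := by
  induction p with
  | nil => simp [sub3]
  | cons a t ih =>
    unfold sub3 at *
    cases a <;> simp [List.filter_cons, List.count_cons] <;> omega

theorem aux_count2 (p : List A) : (sub2 p).length = p.count A.eb + p.count A.bb ∧
    (sub2 p).count A.eb = p.count A.eb ∧ (sub2 p).count A.bb = p.count A.bb := by
  induction p with
  | nil => simp [sub2]
  | cons a t ih =>
    unfold sub2 at *
    cases a <;> simp [List.filter_cons, List.count_cons] <;> omega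

theorem aux_dyck_s4 (w p : List A) (hp : p <+: w)
    (h : IsDyck A.b A.bb (w.filter (fun x => x == A.b || x == A.bb))) :
    p.count A.bb ≤ p.count A.b := by
  have h1 := hp.filter (fun x => x == A.b || x == A.bb)
  have h2 := h.2 (p.filter (fun x => x == A.b || x == A.bb)).length
  rw [← List.prefix_iff_eq_take.1 h1] at h2
  rwa [List.count_filter (by rfl), List.count_filter (by rfl)] at h2

theorem prefixes_sub3_sub2 (w : List A)
    (h : IsDyck A.b A.bb (w.filter (fun x => x == A.b || x == A.bb))) :
    ∀ ℓ : ℕ, ℓ ≤ min (sub2 w).length (sub3 w).length →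
      ((sub3 w).take ℓ).count A.eb ≤ ((sub2 w).take ℓ).count A.eb ∧
      ((sub2 w).take ℓ).count A.bb ≤ ((sub3 w).take ℓ).count A.b := by
  intro ℓ hl
  have hl2 : ℓ ≤ (sub2 w).length := le_trans hl (min_le_left _ _)
  have hl3 : ℓ ≤ (sub3 w).length := le_trans hl (min_le_right _ _)
  obtain ⟨q, hq, hq'⟩ := List.prefix_filter_iff.1 (List.take_prefix ℓ (sub2 w))
  obtain ⟨p, hp, hp'⟩ := List.prefix_filter_iff.1 (List.take_prefix ℓ (sub3 w))
  change _ = sub2 q at hq'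
  change _ = sub3 p at hp'
  have e2 : (sub2 q).length = ℓ := by rw [← hq', List.length_take]; omega
  have e3 : (sub3 p).length = ℓ := by rw [← hp', List.length_take]; omega
  rw [hq', hp']
  obtain ⟨a1, a2, a3⟩ := aux_count2 q
  obtain ⟨b1, b2, b3⟩ := aux_count3 p
  have d := aux_dyck_s4 w p hp h
  rcases List.prefix_or_prefix_of_prefix hp hq with g | g
  · have := g.sublist.count_le A.eb
    omega
  · have := g.sublist.count_le A.eb
    have := g.sublist.count_le A.bb
    omega
end

section
/- Let i, j ≥ 0 and w ∈ W_{i,j}. For every position p with w_p = b there exists a position q > p with w_q = ē such that every letter of w strictly between positions p and q is equal to b. -/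
theorem exists_bb_after (w : List A) (h : w.count A.b = w.count A.bb)
    (hd : IsDyck A.b A.bb (w.filter (fun x => x == A.b || x == A.bb)))
    (p : ℕ) (hp : w[p]? = some A.b) : ∃ q, p < q ∧ w[q]? = some A.bb := by
  obtain ⟨hlt, hpe⟩ := List.getElem?_eq_some_iff.1 hp
  have hw : w = w.take p ++ A.b :: w.drop (p+1) := by
    rw [← hpe, List.getElem_cons_drop, List.take_append_drop]
  have h2 := hd.2 ((w.take p).filter (fun x => x == A.b || x == A.bb)).length
  rw [show (w.filter (fun x => x == A.b || x == A.bb)).take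
      ((w.take p).filter (fun x => x == A.b || x == A.bb)).length
      = (w.take p).filter (fun x => x == A.b || x == A.bb) by
    conv_lhs => rw [← List.take_append_drop p w]
    rw [List.filter_append]
    simp] at h2
  rw [List.count_filter (by decide), List.count_filter (by decide)] at h2
  rw [hw] at h
  simp only [List.count_append, List.count_cons] at h
  simp at h
  have h3 : 0 < (w.drop (p+1)).count A.bb := by omega
  obtain ⟨n, hn⟩ := List.mem_iff_getElem?.1 (List.count_pos_iff.1 h3)
  rw [List.getElem?_drop] at hn
  exact ⟨p + 1 + n, by omega, hn⟩

theorem b_followed_by_eb (i j : ℕ) (w : List A) (hw : w ∈ Wset i j)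
    (p : ℕ) (hp : w[p]? = some A.b) :
    ∃ q, p < q ∧ w[q]? = some A.eb ∧
      ∀ k, p < k → k < q → w[k]? = some A.b := by
  obtain ⟨-, -, hb, hbb, -, -, hd, h4, h5⟩ := hw
  classical
  have hex : ∃ q, p < q ∧ (w[q]? = some A.eb ∨ w[q]? = some A.bb) := by
    obtain ⟨q, h1, h2⟩ := exists_bb_after w (hb.trans hbb.symm) hd p hp
    exact ⟨q, h1, Or.inr h2⟩
  obtain ⟨hr, hr2⟩ := Nat.find_spec hex
  have hmin := fun m => @Nat.find_min _ _ hex m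
  generalize Nat.find hex = r at hr hr2 hmin
  have hreb : w[r]? = some A.eb := by
    rcases hr2 with h | h
    · exact h
    · obtain ⟨k, hk1, hk2, hk⟩ := h4 p r hr hp h
      rcases hk1.eq_or_lt with rfl | hk1
      · simp [hp] at hk
      rcases hk2.eq_or_lt with rfl | hk2
      · exact hk
      exact absurd ⟨hk1, Or.inl hk⟩ (hmin k hk2)
  refine ⟨r, hr, hreb, fun k hpk hkr => ?_⟩
  have hkl : k < w.length := by
    have := (List.getElem?_eq_some_iff.1 hreb).1
    omega
  have hm := hmin k hkr
  have hs : w[k]? = some w[k] := List.getElem?_eq_getElem hkl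
  generalize w[k] = x at hs
  cases x with
  | b => exact hs
  | eb => exact absurd ⟨hpk, Or.inl hs⟩ hm
  | bb => exact absurd ⟨hpk, Or.inr hs⟩ hm
  | e =>
    exfalso
    obtain ⟨l, hl1, hl2, hl⟩ := h5 k r (by omega) hkr hs hreb
    rcases hl2.eq_or_lt with rfl | hl2
    · simp [hreb] at hl
    exact hmin l hl2 ⟨by omega, Or.inr hl⟩
end

section
/- Let i, j ≥ 0 and let w, w' ∈ W_{i,j}. If w|_{{e,b̄}} = w'|_{{e,b̄}}, w|_{{ē,b̄}} = w'|_{{ē,b̄}} and w|_{{ē,b}} = w'|_{{ē,b}}, then w = w'. -/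
theorem mid_no (u a c : List A) (x y z : A) (hx : x ≠ z) (hy : y ≠ z) (ha : z ∉ a)
    (h : ∃ k, u.length ≤ k ∧ k ≤ u.length + 1 + a.length ∧
      (u ++ x :: (a ++ y :: c))[k]? = some z) : False := by
  obtain ⟨k, h1, h2, h3⟩ := h
  obtain ⟨d, rfl⟩ := Nat.exists_eq_add_of_le h1
  rw [List.getElem?_append_right (by omega)] at h3
  simp only [Nat.add_sub_cancel_left] at h3
  rcases d with _ | d
  · simp at h3; exact hx h3
  · simp only [List.getElem?_cons_succ] at h3
    rcases Nat.lt_or_ge d a.length with hd | hd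
    · rw [List.getElem?_append_left hd] at h3
      exact ha (List.mem_of_getElem? h3)
    · have : d = a.length := by omega
      subst this
      simp at h3; exact hy h3

theorem get_fst (u t : List A) (x : A) : (u ++ x :: t)[u.length]? = some x := by simp

theorem get_snd (u a c : List A) (x y : A) :
    (u ++ x :: (a ++ y :: c))[u.length + 1 + a.length]? = some y := by
  rw [List.getElem?_append_right (by omega)]
  have : u.length + 1 + a.length - u.length = a.length + 1 := by omega
  rw [this]; simp

theorem start_e (u v t : List A) (hu : u ≠ []) (h : Conds (u ++ A.e :: v)) :
    sub2 v ≠ A.eb :: t := by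
  intro hv
  unfold sub2 at hv
  obtain ⟨a, c, rfl, ha, -, -⟩ := List.filter_eq_cons_iff.1 hv
  have h5 := h.2.2.2.2 u.length (u.length + 1 + a.length) (List.length_pos_iff.2 hu)
    (by omega) (get_fst _ _ _) (get_snd _ _ _ _ _)
  exact mid_no u a c _ _ _ (by decide) (by decide) (fun hm => ha _ hm (by decide)) h5

theorem start_b (u v t : List A) (h : Conds (u ++ A.b :: v)) :
    sub2 v ≠ A.bb :: t := by
  intro hv
  unfold sub2 at hv
  obtain ⟨a, c, rfl, ha, -, -⟩ := List.filter_eq_cons_iff.1 hv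
  have h5 := h.2.2.2.1 u.length (u.length + 1 + a.length)
    (by omega) (get_fst _ _ _) (get_snd _ _ _ _ _)
  exact mid_no u a c _ _ _ (by decide) (by decide) (fun hm => ha _ hm (by decide)) h5

theorem start_e_ne (u v : List A) (h : Conds (u ++ A.e :: v)) : sub2 v ≠ [] := by
  intro hv
  have hn : A.eb ∉ v := fun hm => List.filter_eq_nil_iff.1 hv _ hm (by decide)
  obtain ⟨hc, hp⟩ := h.2.1
  have := hp (u.filter (fun x => x == A.e || x == A.eb)).length
  rw [List.filter_append] at hc this
  rw [List.take_left] at this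
  have h0 : (v.filter (fun x => x == A.e || x == A.eb)).count A.eb = 0 :=
    List.count_eq_zero.2 (fun hm => hn (List.mem_filter.1 hm).1)
  rw [List.filter_cons_of_pos (by decide)] at hc
  simp only [List.count_append, List.count_cons_self] at hc
  rw [List.count_cons_of_ne (by decide), h0] at hc
  omega

theorem sub2_head (v : List A) : sub2 v = [] ∨ (∃ t, sub2 v = A.eb :: t) ∨
    ∃ t, sub2 v = A.bb :: t := by
  rcases hv : sub2 v with _ | ⟨x, t⟩
  · simp
  · have : x ∈ sub2 v := by simp [hv]
    have := (List.mem_filter.1 this).2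
    cases x <;> simp_all

theorem main_aux (r : List A) : ∀ (r' u : List A), u ≠ [] → Conds (u ++ r) → Conds (u ++ r') →
    sub1 r = sub1 r' → sub2 r = sub2 r' → sub3 r = sub3 r' → r = r' := by
  induction r with
  | nil =>
    intro r' u _ _ _ h1 h2 h3
    rcases r' with _ | ⟨y, v⟩
    · rfl
    · cases y <;> simp [sub1, sub2, sub3] at h1 h2 h3
  | cons x v ih =>
    intro r' u hu hw hw' h1 h2 h3
    rcases r' with _ | ⟨y, v'⟩
    · cases x <;> simp [sub1, sub2, sub3] at h1 h2 h3
    · by_cases hxy : x = y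
      · subst hxy
        congr 1
        refine ih v' (u ++ [x]) (by simp) (by simpa using hw) (by simpa using hw') ?_ ?_ ?_
        · cases x <;> simpa [sub1] using h1
        · cases x <;> simpa [sub2] using h2
        · cases x <;> simpa [sub3] using h3
      · exfalso
        have E : ∀ z, A.e :: z = A.e :: z → sub2 (A.e :: z) = sub2 z := fun z _ => by simp [sub2]
        have B : ∀ z, sub2 (A.b :: z) = sub2 z := fun z => by simp [sub2]
        have EB : ∀ z, sub2 (A.eb :: z) = A.eb :: sub2 z := fun z => by simp [sub2]
        have BB : ∀ z, sub2 (A.bb :: z) = A.bb :: sub2 z := fun z => by simp [sub2]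
        have E := fun z => E z rfl
        cases x <;> cases y <;> try exact hxy rfl
        · exact start_e u v _ hu hw (by rw [← E, h2, EB])
        · rw [E, B] at h2
          rcases sub2_head v with h | ⟨t, h⟩ | ⟨t, h⟩
          · exact start_e_ne u v hw h
          · exact start_e u v t hu hw h
          · exact start_b u v' t hw' (h2 ▸ h)
        · simp [sub1] at h1
        · exact start_e u v' _ hu hw' (by rw [← E, ← h2, EB])
        · simp [sub3] at h3
        · simp [sub2] at h2
        · rw [E, B] at h2
          rcases sub2_head v' with h | ⟨t, h⟩ | ⟨t, h⟩
          · exact start_e_ne u v' hw' h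
          · exact start_e u v' t hu hw' h
          · exact start_b u v t hw (h2 ▸ h)
        · simp [sub3] at h3
        · exact start_b u v _ hw (by rw [← B, h2, BB])
        · simp [sub1] at h1
        · simp [sub2] at h2
        · exact start_b u v' _ hw' (by rw [← B, ← h2, BB])

theorem subwords_determine_word (i j : ℕ) (w w' : List A)
    (hw : w ∈ Wset i j) (hw' : w' ∈ Wset i j)
    (h1 : sub1 w = sub1 w') (h2 : sub2 w = sub2 w') (h3 : sub3 w = sub3 w') :
    w = w' := by
  have c := hw.2.2.2.2
  have c' := hw'.2.2.2.2
  have a := c.1.1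
  have a' := c'.1.1
  rcases w with _ | ⟨x, v⟩
  · simp at a
  rcases w' with _ | ⟨y, v'⟩
  · simp at a'
  simp only [List.getElem?_cons_zero, Option.some.injEq] at a a'
  subst a a'
  congr 1
  exact main_aux v v' [A.e] (by simp) c c' (by simpa [sub1] using h1)
    (by simpa [sub2] using h2) (by simpa [sub3] using h3)
end

section
/- Every word w over the alphabet {e, b, b̄} reduces under →* to a unique irreducible word: if w →* u and w →* v with u and v both irreducible, then u = v. -/
/-- The three-letter alphabet `{e, b, b̄}`; `bb` stands for `b̄`. -/
inductive B : Type
  | e | b | bb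
  deriving DecidableEq

/-- The local closure rewriting relation:
`u·b·e^k·b̄·v → u·e·v` for all words `u, v` and all `k ≥ 0`. -/
def Rw (w w' : List B) : Prop :=
  ∃ u v : List B, ∃ k : ℕ,
    w = u ++ [B.b] ++ List.replicate k B.e ++ [B.bb] ++ v ∧
    w' = u ++ [B.e] ++ v

/-- A word is irreducible if no rewriting step applies to it. -/
def IrreducibleWord (w : List B) : Prop := ¬ ∃ w', Rw w w'

def stepB (s : List B) : B → List B
  | B.e => B.e :: s
  | B.b => B.b :: s
  | B.bb => match s.dropWhile (· == B.e) with
    | B.b :: t => B.e :: t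
    | _ => B.bb :: s

lemma foldl_e (k : ℕ) (s : List B) :
    (List.replicate k B.e).foldl stepB s = List.replicate k B.e ++ s := by
  induction k generalizing s with
  | zero => rfl
  | succ k ih =>
    rw [List.replicate_succ, List.foldl_cons, ih, ← List.replicate_succ, List.replicate_succ']
    simp [stepB]

lemma dropWhile_e (k : ℕ) (s : List B) :
    (List.replicate k B.e ++ B.b :: s).dropWhile (· == B.e) = B.b :: s := by
  induction k with
  | zero => rfl
  | succ k ih => simpa [List.replicate_succ, List.dropWhile_cons] using ih

lemma exists_e (s : List B) :
    ∃ k, s = List.replicate k B.e ++ s.dropWhile (· == B.e) := by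
  induction s with
  | nil => exact ⟨0, rfl⟩
  | cons a s ih =>
    obtain ⟨k, hk⟩ := ih
    cases a with
    | e =>
      refine ⟨k + 1, ?_⟩
      have : (B.e :: s).dropWhile (· == B.e) = s.dropWhile (· == B.e) := rfl
      rw [this, List.replicate_succ, List.cons_append, ← hk]
    | b => exact ⟨0, rfl⟩
    | bb => exact ⟨0, rfl⟩

lemma foldl_rw {w w' : List B} (h : Rw w w') : w.foldl stepB [] = w'.foldl stepB [] := by
  obtain ⟨u, v, k, rfl, rfl⟩ := h
  simp only [List.foldl_append, List.foldl_cons, List.foldl_nil, foldl_e]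
  congr 1
  simp only [stepB, dropWhile_e]

lemma foldl_irr (w s : List B) (h : IrreducibleWord (s.reverse ++ w)) :
    w.foldl stepB s = w.reverse ++ s := by
  induction w generalizing s with
  | nil => rfl
  | cons a w ih =>
    have hs : stepB s a = a :: s := by
      cases a with
      | e => rfl
      | b => rfl
      | bb =>
        obtain ⟨k, hk⟩ := exists_e s
        simp only [stepB]
        split
        · rename_i t ht
          exfalso
          apply h
          rw [ht] at hk
          refine ⟨_, t.reverse, w, k, ?_, rfl⟩
          rw [hk]
          simp
        · rfl
    rw [List.foldl_cons, hs, ih]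
    · simp
    · simpa using h

lemma foldl_star {w u : List B} (h : Relation.ReflTransGen Rw w u) :
    w.foldl stepB [] = u.foldl stepB [] := by
  induction h with
  | refl => rfl
  | tail _ h ih => exact ih.trans (foldl_rw h)

theorem unique_normal_form (w u v : List B)
    (hu : Relation.ReflTransGen Rw w u) (hv : Relation.ReflTransGen Rw w v)
    (hiu : IrreducibleWord u) (hiv : IrreducibleWord v) : u = v := by
  have h := (foldl_star hu).symm.trans (foldl_star hv)
  rw [foldl_irr u [] (by simpa using hiu), foldl_irr v [] (by simpa using hiv)] at h
  simpa using h
end
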